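/- Let λ < λ₀ = 3/2^(2/3) be fixed. Then there exists ε₀ > 0 such that for every ε ∈ (0, ε₀), any two solutions u and v of (∗) on [0, π] satisfying u'(0) = v'(0) = 0 and u'(π) = v'(π) = 0 coincide on [0, π]; that is, for such ε the equation (∗) has at most one solution with u'(0) = 0 and u'(π) = 0 (namely the antisymmetric solution u_p). -/

import Mathlib

open Real Set

/-- `u`, with derivative `u'`, solves `ε² u'' = u³ - λ u + cos t` on `[0, π]` with Neumann boundary
conditions. -/
structure IsNeumannSol (ε lam : ℝ) (u u' : ℝ → ℝ) : Prop where
  hasDerivAt : ∀ t, HasDerivAt u (u' t) t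
  hasDerivAt_deriv : ∀ t ∈ Icc (0 : ℝ) π,
    HasDerivAt u' ((u t ^ 3 - lam * u t + Real.cos t) / ε ^ 2) t
  deriv_zero : u' 0 = 0
  deriv_pi : u' π = 0

/-! ### A minimum principle -/

lemma exists_lt_right_of_concave {w w' : ℝ → ℝ} {c t₀ b : ℝ} (hb : t₀ < b)
    (h1 : ∀ t ∈ Icc t₀ b, HasDerivAt w (w' t) t) (h2 : HasDerivAt w' c t₀)
    (h0 : w' t₀ ≤ 0) (hc : c < 0) : ∃ t ∈ Icc t₀ b, w t < w t₀ := by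
  have hs := (hasDerivAt_iff_tendsto_slope.1 h2).eventually_lt_const hc
  have hs' : ∀ᶠ t in nhdsWithin t₀ (Ioi t₀), slope w' t₀ t < 0 :=
    hs.filter_mono (nhdsWithin_mono _ fun x hx => ne_of_gt hx)
  obtain ⟨r, hr, hrs⟩ := mem_nhdsGT_iff_exists_Ioo_subset.1 hs'
  obtain ⟨t₁, h01, h1r⟩ := exists_between (lt_min hr hb)
  rw [lt_min_iff] at h1r
  refine ⟨t₁, ⟨h01.le, h1r.2.le⟩, ?_⟩
  have hanti : StrictAntiOn w (Icc t₀ t₁) := by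
    refine strictAntiOn_of_deriv_neg (convex_Icc _ _)
      (fun t ht => (h1 t ⟨ht.1, ht.2.trans h1r.2.le⟩).continuousAt.continuousWithinAt) ?_
    intro t ht
    rw [interior_Icc] at ht
    rw [(h1 t ⟨ht.1.le, ht.2.le.trans h1r.2.le⟩).deriv]
    have h := hrs ⟨ht.1, ht.2.trans h1r.1⟩
    rw [mem_ofPred_eq, slope_def_field] at h
    have hpos : 0 < t - t₀ := sub_pos.2 ht.1
    rw [div_lt_iff₀ hpos] at h
    linarith
  exact hanti (left_mem_Icc.2 h01.le) (right_mem_Icc.2 h01.le) h01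

lemma nonneg_of_neg_imp_concave {w w' w'' : ℝ → ℝ} {a b : ℝ} (hab : a < b)
    (h1 : ∀ t ∈ Icc a b, HasDerivAt w (w' t) t)
    (h2 : ∀ t ∈ Icc a b, HasDerivAt w' (w'' t) t)
    (ha : w' a ≤ 0) (hb : 0 ≤ w' b) (hneg : ∀ t ∈ Icc a b, w t < 0 → w'' t < 0) :
    ∀ t ∈ Icc a b, 0 ≤ w t := by
  obtain ⟨t₀, ht₀, hmin⟩ := isCompact_Icc.exists_isMinOn (nonempty_Icc.2 hab.le)
    (fun t ht => (h1 t ht).continuousAt.continuousWithinAt : ContinuousOn w (Icc a b))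
  by_contra! hcon
  obtain ⟨t, ht, hwt⟩ := hcon
  have hc : w'' t₀ < 0 := hneg t₀ ht₀ ((hmin ht).trans_lt hwt)
  rcases ht₀.2.lt_or_eq with hlt | rfl
  · have h0 : w' t₀ ≤ 0 := by
      rcases ht₀.1.lt_or_eq with hgt | rfl
      · exact ((hmin.isLocalMin (Icc_mem_nhds hgt hlt)).hasDerivAt_eq_zero (h1 t₀ ht₀)).le
      · exact ha
    obtain ⟨t₁, ht₁, h⟩ := exists_lt_right_of_concave hlt
      (fun t ht => h1 t ⟨ht₀.1.trans ht.1, ht.2⟩) (h2 t₀ ht₀) h0 hc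
    exact absurd (hmin ⟨ht₀.1.trans ht₁.1, ht₁.2⟩) (not_le.2 h)
  · have hd : ∀ t ∈ Icc (-t₀) (-a), HasDerivAt (fun s => w (-s)) (-w' (-t)) t := by
      intro t ht
      have hmem : -t ∈ Icc a t₀ := ⟨by linarith [ht.2], by linarith [ht.1]⟩
      exact ((h1 (-t) hmem).comp t (hasDerivAt_neg t)).congr_deriv (by simp)
    have hd2 : HasDerivAt (fun s => -w' (-s)) (w'' t₀) (-t₀) := by
      have h := h2 t₀ ht₀
      rw [← neg_neg t₀] at h
      simpa using (h.comp (-t₀) (hasDerivAt_neg (-t₀))).fun_neg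
    obtain ⟨t₁, ht₁, h⟩ := exists_lt_right_of_concave (neg_lt_neg hab) hd hd2
      (by simpa using hb) hc
    have hmem : -t₁ ∈ Icc a t₀ := ⟨by linarith [ht₁.2], by linarith [ht₁.1]⟩
    simp only [neg_neg] at h
    exact absurd (hmin hmem) (not_le.2 h)

/-! ### A priori bounds -/

lemma exists_cubic_root {lam : ℝ} (hlam : lam < (3 : ℝ) / (2 : ℝ) ^ ((2 : ℝ) / 3)) :
    ∃ R > (0 : ℝ), R ^ 3 - lam * R = 1 ∧ 4 * lam < 3 * R ^ 2 := by
  obtain ⟨R, hR, hroot⟩ : ∃ R ∈ Icc (0 : ℝ) (1 + |lam|), R ^ 3 - lam * R = 1 := by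
    have hcont : ContinuousOn (fun x : ℝ => x ^ 3 - lam * x) (Icc 0 (1 + |lam|)) := by fun_prop
    refine intermediate_value_Icc (by positivity) hcont ⟨by norm_num, ?_⟩
    have h1 := le_abs_self lam
    have h2 := abs_nonneg lam
    change 1 ≤ (1 + |lam|) ^ 3 - lam * (1 + |lam|)
    nlinarith [mul_nonneg h2 h2, mul_nonneg (mul_nonneg h2 h2) h2,
      mul_nonneg h2 (sub_nonneg.2 h1)]
  have hR0 : 0 < R := lt_of_le_of_ne hR.1 (by rintro rfl; norm_num at hroot)
  refine ⟨R, hR0, hroot, ?_⟩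
  by_contra! hcon
  have ha : (0 : ℝ) < (2 : ℝ) ^ ((2 : ℝ) / 3) := by positivity
  have ha3 : ((2 : ℝ) ^ ((2 : ℝ) / 3)) ^ 3 = 4 := by
    rw [← Real.rpow_natCast, ← Real.rpow_mul (by norm_num)]
    norm_num
  have hlam0 : 0 < lam := by nlinarith [sq_pos_of_pos hR0]
  have hla := (lt_div_iff₀ ha).1 hlam
  have h27 : (lam * (2 : ℝ) ^ ((2 : ℝ) / 3)) ^ 3 < 3 ^ 3 :=
    pow_lt_pow_left₀ hla (by positivity) (by norm_num)
  rw [mul_pow, ha3] at h27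
  have hR3 : 4 ≤ R ^ 3 := by nlinarith [mul_le_mul_of_nonneg_left hcon hR0.le]
  have hl3 : (3 * R ^ 2) ^ 3 ≤ (4 * lam) ^ 3 := pow_le_pow_left₀ (by positivity) hcon 3
  nlinarith

namespace IsNeumannSol

variable {ε lam R : ℝ} {u u' v v' : ℝ → ℝ}

lemma reflect (hu : IsNeumannSol ε lam u u') :
    IsNeumannSol ε lam (fun t => -u (π - t)) (fun t => u' (π - t)) where
  hasDerivAt t := by
    simpa using ((hu.hasDerivAt (π - t)).comp t ((hasDerivAt_id t).const_sub π)).fun_neg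
  hasDerivAt_deriv t ht := by
    have hmem : π - t ∈ Icc (0 : ℝ) π := ⟨by linarith [ht.2], by linarith [ht.1]⟩
    have h := (hu.hasDerivAt_deriv (π - t) hmem).comp t ((hasDerivAt_id t).const_sub π)
    refine h.congr_deriv ?_
    rw [Real.cos_pi_sub]
    ring
  deriv_zero := by simpa using hu.deriv_pi
  deriv_pi := by simpa using hu.deriv_zero

lemma neg_le (hε : 0 < ε) (hroot : R ^ 3 - lam * R = 1) (hlt : 4 * lam < 3 * R ^ 2)
    (hu : IsNeumannSol ε lam u u') : ∀ t ∈ Icc (0 : ℝ) π, -R ≤ u t := by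
  have h := nonneg_of_neg_imp_concave (w := fun t => u t + R) pi_pos
    (fun t _ => (hu.hasDerivAt t).add_const R) hu.hasDerivAt_deriv
    hu.deriv_zero.le hu.deriv_pi.ge ?_
  · intro t ht
    linarith [h t ht]
  · intro t _ hneg
    refine div_neg_of_neg_of_pos ?_ (by positivity)
    have hcos := Real.cos_le_one t
    have hQ : 0 < (u t - R / 2) ^ 2 + (3 * R ^ 2 / 4 - lam) := by
      have := sq_nonneg (u t - R / 2)
      linarith
    have := mul_neg_of_neg_of_pos hneg hQ
    nlinarith

lemma le (hε : 0 < ε) (hroot : R ^ 3 - lam * R = 1) (hlt : 4 * lam < 3 * R ^ 2)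
    (hu : IsNeumannSol ε lam u u') : ∀ t ∈ Icc (0 : ℝ) π, u t ≤ R := by
  intro t ht
  have h := hu.reflect.neg_le hε hroot hlt (π - t) ⟨by linarith [ht.2], by linarith [ht.1]⟩
  simp only [sub_sub_cancel] at h
  linarith

/-- Near `t = 0` the solution is close to the unique real root `-R` of `y³ - λ y + 1`. -/
lemma add_le (hε : 0 < ε) (hroot : R ^ 3 - lam * R = 1) {q : ℝ} (hq : 0 < q)
    (hqdef : q = 3 * R ^ 2 / 4 - lam) (hu : IsNeumannSol ε lam u u') :
    ∀ t ∈ Icc (0 : ℝ) π, u t + R ≤ ε ^ 2 / q ^ 2 + t ^ 2 / (2 * q) := by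
  have hlow := hu.neg_le hε hroot (by linarith)
  have h := nonneg_of_neg_imp_concave
    (w := fun t => ε ^ 2 / q ^ 2 + t ^ 2 / (2 * q) - (u t + R)) (w' := fun t => t / q - u' t)
    (w'' := fun t => 1 / q - (u t ^ 3 - lam * u t + Real.cos t) / ε ^ 2) pi_pos ?_ ?_ ?_ ?_ ?_
  · intro t ht
    linarith [h t ht]
  · intro t _
    refine ((((hasDerivAt_pow 2 t).div_const (2 * q)).const_add (ε ^ 2 / q ^ 2)).fun_sub
      ((hu.hasDerivAt t).add_const R)).congr_deriv ?_
    field_simp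
    norm_num
    ring
  · intro t ht
    exact ((hasDerivAt_id t).div_const q).fun_sub (hu.hasDerivAt_deriv t ht)
  · simp [hu.deriv_zero]
  · simp only [hu.deriv_pi, sub_zero]
    positivity
  · intro t ht hneg
    have hcos := Real.one_sub_sq_div_two_le_cos (x := t)
    have hp : 0 ≤ u t + R := by linarith [hlow t ht]
    have hbig : ε ^ 2 / q + t ^ 2 / 2 < q * (u t + R) := by
      have h1 : ε ^ 2 / q ^ 2 + t ^ 2 / (2 * q) < u t + R := by linarith
      have h2 := mul_lt_mul_of_pos_left h1 hq
      have h3 : q * (ε ^ 2 / q ^ 2 + t ^ 2 / (2 * q)) = ε ^ 2 / q + t ^ 2 / 2 := by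
        field_simp
      linarith
    have hF : q * (u t + R) - t ^ 2 / 2 ≤ u t ^ 3 - lam * u t + Real.cos t := by
      have := mul_nonneg hp (sq_nonneg (u t - R / 2))
      subst hqdef
      nlinarith
    have h4 : 1 / q < (u t ^ 3 - lam * u t + Real.cos t) / ε ^ 2 := by
      rw [lt_div_iff₀ (by positivity)]
      have : 1 / q * ε ^ 2 = ε ^ 2 / q := by ring
      linarith
    linarith

end IsNeumannSol

/-! ### Uniqueness of ordered solutions -/

/-- The energy of the Duffing equation. -/
noncomputable def duffingEnergy (ε lam : ℝ) (u u' : ℝ → ℝ) (t : ℝ) : ℝ :=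
  ε ^ 2 * u' t ^ 2 / 2 - u t ^ 4 / 4 + lam * u t ^ 2 / 2 - u t * Real.cos t

lemma duffingEnergy_reflect (ε lam : ℝ) (u u' : ℝ → ℝ) :
    duffingEnergy ε lam (fun t => -u (π - t)) (fun t => u' (π - t)) (π / 2) =
      duffingEnergy ε lam u u' (π / 2) := by
  simp only [duffingEnergy, Real.cos_pi_div_two, sub_half]
  ring

namespace IsNeumannSol

variable {ε lam R : ℝ} {u u' v v' : ℝ → ℝ}

lemma hasDerivAt_energy (hε : 0 < ε) (hu : IsNeumannSol ε lam u u') {t : ℝ}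
    (ht : t ∈ Icc (0 : ℝ) π) :
    HasDerivAt (duffingEnergy ε lam u u') (u t * Real.sin t) t := by
  have h1 := hu.hasDerivAt t
  have h2 := hu.hasDerivAt_deriv t ht
  have h := ((((((h2.fun_pow 2).const_mul (ε ^ 2)).div_const 2).fun_sub
    ((h1.fun_pow 4).div_const 4)).fun_add (((h1.fun_pow 2).const_mul lam).div_const 2)).fun_sub
    (h1.fun_mul (Real.hasDerivAt_cos t)))
  refine h.congr_deriv ?_
  field_simp
  norm_num
  ring

lemma energy_le_of_le (hε : 0 < ε) (hR : 0 < R) (hroot : R ^ 3 - lam * R = 1) {q δ : ℝ}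
    (hq : 0 < q) (hqdef : q = 3 * R ^ 2 / 4 - lam) (hδ : 0 < δ) (hδ1 : δ ≤ 1)
    (hδq : δ ^ 2 ≤ q * R / 2) (hε1 : ε ^ 2 ≤ q ^ 2 * R / 4)
    (hε2 : ε ^ 2 * (3 * R ^ 2 - lam) < q ^ 2 * (1 - Real.cos δ))
    (hu : IsNeumannSol ε lam u u') (hv : IsNeumannSol ε lam v v')
    (hle : ∀ t ∈ Icc (0 : ℝ) π, u t ≤ v t) :
    duffingEnergy ε lam u u' (π / 2) ≤ duffingEnergy ε lam v v' (π / 2) ∧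
      (duffingEnergy ε lam v v' (π / 2) ≤ duffingEnergy ε lam u u' (π / 2) →
        ∀ t ∈ Ioo (0 : ℝ) (π / 2), u t = v t) := by
  have hpi := Real.pi_gt_three
  have hqR : 0 ≤ 3 * R ^ 2 - lam := by nlinarith [sq_nonneg R]
  have hulow := hu.neg_le hε hroot (by linarith)
  have huup := hu.add_le hε hroot hq hqdef
  have hvup := hv.add_le hε hroot hq hqdef
  set e := ε ^ 2 / q ^ 2 with he
  have he0 : 0 ≤ e := by positivity
  have heR : e ≤ R / 4 := by
    rw [he, div_le_iff₀ (by positivity)]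
    linarith
  have hem : e * (3 * R ^ 2 - lam) < 1 - Real.cos δ := by
    rw [he, div_mul_eq_mul_div, div_lt_iff₀ (by positivity)]
    linarith
  have hnear : ∀ t ∈ Icc (0 : ℝ) δ, e + t ^ 2 / (2 * q) ≤ R / 2 := by
    intro t ht
    have h1 : t ^ 2 / (2 * q) ≤ R / 4 := by
      rw [div_le_iff₀ (by positivity)]
      have := pow_le_pow_left₀ ht.1 ht.2 2
      linarith
    linarith
  have hz1 : ∀ t, HasDerivAt (fun s => v s - u s) (v' t - u' t) t := fun t =>
    (hv.hasDerivAt t).fun_sub (hu.hasDerivAt t)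
  have hz'mono : MonotoneOn (fun s => v' s - u' s) (Icc 0 δ) := by
    have hd : ∀ t ∈ Icc (0 : ℝ) δ, HasDerivAt (fun s => v' s - u' s) _ t := fun t ht =>
      (hv.hasDerivAt_deriv t ⟨ht.1, by linarith [ht.2]⟩).fun_sub
        (hu.hasDerivAt_deriv t ⟨ht.1, by linarith [ht.2]⟩)
    refine monotoneOn_of_deriv_nonneg (convex_Icc _ _)
      (fun t ht => (hd t ht).continuousAt.continuousWithinAt) ?_ ?_
    · intro t ht
      exact (hd t (interior_subset ht)).differentiableAt.differentiableWithinAt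
    · intro t ht
      have ht := interior_subset ht
      have htpi : t ∈ Icc (0 : ℝ) π := ⟨ht.1, by linarith [ht.2]⟩
      rw [(hd t ht).deriv, ← sub_div]
      refine div_nonneg ?_ (by positivity)
      have hz := sub_nonneg.2 (hle t htpi)
      have h1 : R / 2 ≤ -u t := by linarith [hnear t ht, huup t htpi]
      have h2 : R / 2 ≤ -v t := by linarith [hnear t ht, hvup t htpi]
      have h3 : 0 ≤ u t ^ 2 + u t * v t + v t ^ 2 - lam := by
        nlinarith [mul_le_mul h1 h1 (by positivity) (by linarith),
          mul_le_mul h2 h2 (by positivity) (by linarith),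
          mul_le_mul h1 h2 (by positivity) (by linarith)]
      have := mul_nonneg hz h3
      linarith
  have hz'0 : ∀ t ∈ Icc (0 : ℝ) δ, 0 ≤ v' t - u' t := by
    intro t ht
    have := hz'mono (left_mem_Icc.2 hδ.le) ht ht.1
    simpa [hu.deriv_zero, hv.deriv_zero] using this
  have hzmono : MonotoneOn (fun s => v s - u s) (Icc 0 δ) := by
    refine monotoneOn_of_deriv_nonneg (convex_Icc _ _)
      (fun t _ => (hz1 t).continuousAt.continuousWithinAt)
      (fun t _ => (hz1 t).differentiableAt.differentiableWithinAt) fun t ht => ?_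
    rw [(hz1 t).deriv]
    exact hz'0 t (interior_subset ht)
  have hzge : ∀ t ∈ Icc (0 : ℝ) δ, v 0 - u 0 ≤ v t - u t := fun t ht =>
    hzmono (left_mem_Icc.2 hδ.le) ht ht.1
  set D : ℝ → ℝ := fun t => duffingEnergy ε lam v v' t - duffingEnergy ε lam u u' t with hD
  have hDd : ∀ t ∈ Icc (0 : ℝ) π, HasDerivAt D ((v t - u t) * Real.sin t) t := fun t ht =>
    ((hv.hasDerivAt_energy hε ht).fun_sub (hu.hasDerivAt_energy hε ht)).congr_deriv (by ring)
  have hDmono : MonotoneOn D (Icc 0 (π / 2)) := by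
    have hsub : ∀ t ∈ Icc (0 : ℝ) (π / 2), t ∈ Icc (0 : ℝ) π := fun t ht =>
      ⟨ht.1, by linarith [ht.2]⟩
    refine monotoneOn_of_deriv_nonneg (convex_Icc _ _)
      (fun t ht => (hDd t (hsub t ht)).continuousAt.continuousWithinAt)
      (fun t ht => (hDd t (hsub t
        (interior_subset ht))).differentiableAt.differentiableWithinAt) fun t ht => ?_
    have htpi := hsub t (interior_subset ht)
    rw [(hDd t htpi).deriv]
    exact mul_nonneg (sub_nonneg.2 (hle t htpi)) (Real.sin_nonneg_of_nonneg_of_le_pi htpi.1 htpi.2)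
  have hDδ : D 0 + (v 0 - u 0) * (1 - Real.cos δ) ≤ D δ := by
    have hd : ∀ t ∈ Icc (0 : ℝ) δ, HasDerivAt (fun s => D s + (v 0 - u 0) * Real.cos s)
        ((v t - u t - (v 0 - u 0)) * Real.sin t) t := fun t ht =>
      ((hDd t ⟨ht.1, by linarith [ht.2]⟩).fun_add
        ((Real.hasDerivAt_cos t).const_mul (v 0 - u 0))).congr_deriv (by ring)
    have hmono : MonotoneOn (fun s => D s + (v 0 - u 0) * Real.cos s) (Icc 0 δ) := by
      refine monotoneOn_of_deriv_nonneg (convex_Icc _ _)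
        (fun t ht => (hd t ht).continuousAt.continuousWithinAt)
        (fun t ht => (hd t (interior_subset ht)).differentiableAt.differentiableWithinAt)
        fun t ht => ?_
      have ht := interior_subset ht
      rw [(hd t ht).deriv]
      exact mul_nonneg (sub_nonneg.2 (hzge t ht))
        (Real.sin_nonneg_of_nonneg_of_le_pi ht.1 (by linarith [ht.2]))
    have := hmono (left_mem_Icc.2 hδ.le) (right_mem_Icc.2 hδ.le) hδ.le
    simp only [Real.cos_zero, mul_one] at this
    linarith
  have h0mem : (0 : ℝ) ∈ Icc (0 : ℝ) π := left_mem_Icc.2 pi_pos.le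
  have hz0 : 0 ≤ v 0 - u 0 := sub_nonneg.2 (hle 0 h0mem)
  have hD0 : -((v 0 - u 0) * (e * (3 * R ^ 2 - lam))) ≤ D 0 := by
    obtain ⟨a, ha⟩ : ∃ a, a = u 0 + R := ⟨_, rfl⟩
    obtain ⟨b, hb⟩ : ∃ b, b = v 0 + R := ⟨_, rfl⟩
    have ha0 : 0 ≤ a := by linarith [hulow 0 h0mem]
    have hab : a ≤ b := by linarith
    have hbe : b ≤ e := by simpa [hb] using hvup 0 h0mem
    have hDeq : D 0 = -((v 0 - u 0) * ((a + b) * (a ^ 2 + b ^ 2) / 4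
        - R * (a ^ 2 + a * b + b ^ 2) + (3 * R ^ 2 - lam) * (a + b) / 2)) := by
      have hua : u 0 = a - R := by linarith
      have hvb : v 0 = b - R := by linarith
      simp only [hD, duffingEnergy, hu.deriv_zero, hv.deriv_zero, Real.cos_zero, hua, hvb]
      linear_combination (b - a) * hroot
    rw [hDeq]
    refine neg_le_neg (mul_le_mul_of_nonneg_left ?_ hz0)
    have h1 : (a + b) * (a ^ 2 + b ^ 2) / 4 ≤ R * (a ^ 2 + b ^ 2) := by
      have : (a + b) * (a ^ 2 + b ^ 2) ≤ (4 * R) * (a ^ 2 + b ^ 2) :=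
        mul_le_mul_of_nonneg_right (by linarith) (by positivity)
      linarith
    have h2 : 0 ≤ R * (a * b) := by have := ha0.trans hab; positivity
    have h3 : (3 * R ^ 2 - lam) * (a + b) / 2 ≤ e * (3 * R ^ 2 - lam) := by
      have := mul_le_mul_of_nonneg_left (by linarith : a + b ≤ 2 * e) hqR
      linarith
    linarith
  have hδmem : δ ∈ Icc (0 : ℝ) (π / 2) := ⟨hδ.le, by linarith⟩
  have h0mem' : (0 : ℝ) ∈ Icc (0 : ℝ) (π / 2) := left_mem_Icc.2 (by positivity)
  have hemem : π / 2 ∈ Icc (0 : ℝ) (π / 2) := right_mem_Icc.2 (by positivity)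
  have hDhalf : D δ ≤ D (π / 2) := hDmono hδmem hemem hδmem.2
  have hlow : (v 0 - u 0) * (1 - Real.cos δ - e * (3 * R ^ 2 - lam)) ≤ D (π / 2) := by linarith
  have hpos : 0 < 1 - Real.cos δ - e * (3 * R ^ 2 - lam) := by linarith
  refine ⟨sub_nonneg.1 ((mul_nonneg hz0 hpos.le).trans hlow), fun hge => ?_⟩
  have hDnonpos : D (π / 2) ≤ 0 := sub_nonpos.2 hge
  have hzz : v 0 - u 0 = 0 := by
    by_contra hne
    have := mul_pos (lt_of_le_of_ne hz0 (Ne.symm hne)) hpos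
    linarith
  rw [hzz] at hD0
  have hDzero : ∀ t ∈ Icc (0 : ℝ) (π / 2), D t = 0 := fun t ht => by
    have h1 := hDmono h0mem' ht ht.1
    have h2 := hDmono ht hemem ht.2
    linarith
  intro t ht
  have hloc : D =ᶠ[nhds t] fun _ => 0 :=
    Filter.eventually_of_mem (Icc_mem_nhds ht.1 ht.2) hDzero
  have hd0 : (v t - u t) * Real.sin t = 0 :=
    (hDd t ⟨ht.1.le, by linarith [ht.2]⟩).unique
      ((hasDerivAt_const t (0 : ℝ)).congr_of_eventuallyEq hloc)
  have hsin : Real.sin t ≠ 0 := (Real.sin_pos_of_pos_of_lt_pi ht.1 (by linarith [ht.2])).ne'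
  have := (mul_eq_zero.1 hd0).resolve_right hsin
  linarith

lemma eq_of_le (hε : 0 < ε) (hR : 0 < R) (hroot : R ^ 3 - lam * R = 1) {q δ : ℝ}
    (hq : 0 < q) (hqdef : q = 3 * R ^ 2 / 4 - lam) (hδ : 0 < δ) (hδ1 : δ ≤ 1)
    (hδq : δ ^ 2 ≤ q * R / 2) (hε1 : ε ^ 2 ≤ q ^ 2 * R / 4)
    (hε2 : ε ^ 2 * (3 * R ^ 2 - lam) < q ^ 2 * (1 - Real.cos δ))
    (hu : IsNeumannSol ε lam u u') (hv : IsNeumannSol ε lam v v')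
    (hle : ∀ t ∈ Icc (0 : ℝ) π, u t ≤ v t) : ∀ t ∈ Icc (0 : ℝ) π, u t = v t := by
  obtain ⟨h1, h1'⟩ := hu.energy_le_of_le hε hR hroot hq hqdef hδ hδ1 hδq hε1 hε2 hv hle
  obtain ⟨h2, h2'⟩ := hv.reflect.energy_le_of_le hε hR hroot hq hqdef hδ hδ1 hδq hε1 hε2
    hu.reflect fun t ht => neg_le_neg (hle (π - t) ⟨by linarith [ht.2], by linarith [ht.1]⟩)
  rw [duffingEnergy_reflect, duffingEnergy_reflect] at h2 h2'
  have heq1 := h1' h2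
  have heq2 := h2' h1
  have hcu : Continuous u := continuous_iff_continuousAt.2 fun t => (hu.hasDerivAt t).continuousAt
  have hcv : Continuous v := continuous_iff_continuousAt.2 fun t => (hv.hasDerivAt t).continuousAt
  have hclosed : IsClosed {t | u t = v t} := isClosed_eq hcu hcv
  have hhalf : (0 : ℝ) ≠ π / 2 := by positivity
  have hsub1 : Icc (0 : ℝ) (π / 2) ⊆ {t | u t = v t} := by
    rw [← closure_Ioo hhalf]
    exact closure_minimal heq1 hclosed
  have hsub2 : Icc (π / 2) π ⊆ {t | u t = v t} := by
    rw [← closure_Ioo (by linarith [pi_pos] : π / 2 ≠ π)]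
    refine closure_minimal (fun t ht => ?_) hclosed
    have h := heq2 (π - t) ⟨by linarith [ht.2], by linarith [ht.1]⟩
    simp only [sub_sub_cancel] at h
    exact (neg_injective h).symm
  intro t ht
  rcases le_total t (π / 2) with h | h
  · exact hsub1 ⟨ht.1, h⟩
  · exact hsub2 ⟨h, ht.2⟩

end IsNeumannSol

/-! ### The maximal solution -/

/-- The solution of `y'' = k² y - G` on `[0, π]` with Neumann boundary conditions. -/
noncomputable def neumannGreen (k : ℝ) (G : ℝ → ℝ) (t : ℝ) : ℝ :=
  (Real.cosh (k * (π - t)) * (∫ s in (0 : ℝ)..t, Real.cosh (k * s) * G s) +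
    Real.cosh (k * t) * ∫ s in t..π, Real.cosh (k * (π - s)) * G s) / (k * Real.sinh (k * π))

/-- The derivative of `neumannGreen k G`. -/
noncomputable def neumannGreenDeriv (k : ℝ) (G : ℝ → ℝ) (t : ℝ) : ℝ :=
  (-Real.sinh (k * (π - t)) * (∫ s in (0 : ℝ)..t, Real.cosh (k * s) * G s) +
    Real.sinh (k * t) * ∫ s in t..π, Real.cosh (k * (π - s)) * G s) / Real.sinh (k * π)

section Green

variable {k : ℝ} {G : ℝ → ℝ}

lemma hasDerivAt_integral_cosh (hG : Continuous G) (t : ℝ) :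
    HasDerivAt (fun x => ∫ s in (0 : ℝ)..x, Real.cosh (k * s) * G s) (Real.cosh (k * t) * G t) t :=
  have hc : Continuous fun s => Real.cosh (k * s) * G s := by fun_prop
  (hc.integral_hasStrictDerivAt 0 t).hasDerivAt

lemma hasDerivAt_integral_cosh_reflect (hG : Continuous G) (t : ℝ) :
    HasDerivAt (fun x => ∫ s in x..π, Real.cosh (k * (π - s)) * G s)
      (-(Real.cosh (k * (π - t)) * G t)) t :=
  have hc : Continuous fun s => Real.cosh (k * (π - s)) * G s := by fun_prop
  intervalIntegral.integral_hasDerivAt_left (hc.intervalIntegrable _ _)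
    (hc.stronglyMeasurableAtFilter _ _) hc.continuousAt

lemma hasDerivAt_neumannGreen (hk : 0 < k) (hG : Continuous G) (t : ℝ) :
    HasDerivAt (neumannGreen k G) (neumannGreenDeriv k G t) t := by
  have hs : Real.sinh (k * π) ≠ 0 := (Real.sinh_pos_iff.2 (by positivity)).ne'
  have h1 : HasDerivAt (fun x => Real.cosh (k * (π - x))) (Real.sinh (k * (π - t)) * (k * -1)) t :=
    (((hasDerivAt_id t).const_sub π).const_mul k).cosh
  have h2 : HasDerivAt (fun x => Real.cosh (k * x)) (Real.sinh (k * t) * (k * 1)) t :=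
    ((hasDerivAt_id t).const_mul k).cosh
  refine (((h1.fun_mul (hasDerivAt_integral_cosh hG t)).fun_add
    (h2.fun_mul (hasDerivAt_integral_cosh_reflect hG t))).div_const _).congr_deriv ?_
  rw [neumannGreenDeriv]
  field_simp
  ring

lemma hasDerivAt_neumannGreenDeriv (hk : 0 < k) (hG : Continuous G) (t : ℝ) :
    HasDerivAt (neumannGreenDeriv k G) (k ^ 2 * neumannGreen k G t - G t) t := by
  have hs : Real.sinh (k * π) ≠ 0 := (Real.sinh_pos_iff.2 (by positivity)).ne'
  have h1 : HasDerivAt (fun x => -Real.sinh (k * (π - x)))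
      (-(Real.cosh (k * (π - t)) * (k * -1))) t :=
    (((hasDerivAt_id t).const_sub π).const_mul k).sinh.fun_neg
  have h2 : HasDerivAt (fun x => Real.sinh (k * x)) (Real.cosh (k * t) * (k * 1)) t :=
    ((hasDerivAt_id t).const_mul k).sinh
  have hadd : Real.sinh (k * (π - t)) * Real.cosh (k * t) +
      Real.cosh (k * (π - t)) * Real.sinh (k * t) = Real.sinh (k * π) := by
    rw [← Real.sinh_add]
    ring_nf
  refine (((h1.fun_mul (hasDerivAt_integral_cosh hG t)).fun_add
    (h2.fun_mul (hasDerivAt_integral_cosh_reflect hG t))).div_const _).congr_deriv ?_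
  rw [neumannGreen]
  field_simp
  linear_combination (-G t) * hadd

lemma neumannGreenDeriv_zero : neumannGreenDeriv k G 0 = 0 := by simp [neumannGreenDeriv]

lemma neumannGreenDeriv_pi : neumannGreenDeriv k G π = 0 := by simp [neumannGreenDeriv]

lemma continuous_neumannGreen (hG : MeasureTheory.LocallyIntegrable G) :
    Continuous (neumannGreen k G) := by
  have hint : ∀ {c : ℝ → ℝ}, Continuous c → ∀ a b,
      IntervalIntegrable (fun s => c s * G s) MeasureTheory.volume a b := fun hc a b =>
    (hG.integrableOn_isCompact isCompact_uIcc).intervalIntegrable.continuousOn_mul hc.continuousOn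
  have h1 : Continuous fun t => ∫ s in (0 : ℝ)..t, Real.cosh (k * s) * G s :=
    intervalIntegral.continuous_primitive (hint (by fun_prop)) 0
  have h2 : Continuous fun t => ∫ s in t..π, Real.cosh (k * (π - s)) * G s := by
    simp_rw [intervalIntegral.integral_symm π]
    exact (intervalIntegral.continuous_primitive (hint (by fun_prop)) π).neg
  unfold neumannGreen
  fun_prop

lemma tendsto_neumannGreen {Gs : ℕ → ℝ → ℝ} {B : ℝ} (hcont : ∀ n, Continuous (Gs n))
    (hB : ∀ n t, |Gs n t| ≤ B)
    (hlim : ∀ t, Filter.Tendsto (fun n => Gs n t) Filter.atTop (nhds (G t))) (t : ℝ) :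
    Filter.Tendsto (fun n => neumannGreen k (Gs n) t) Filter.atTop (nhds (neumannGreen k G t)) := by
  have key : ∀ {c : ℝ → ℝ}, Continuous c → ∀ a b : ℝ,
      Filter.Tendsto (fun n => ∫ s in a..b, c s * Gs n s) Filter.atTop
        (nhds (∫ s in a..b, c s * G s)) := by
    intro c hc a b
    refine intervalIntegral.tendsto_integral_filter_of_dominated_convergence (fun s => |c s| * B)
      (.of_forall fun n => (hc.mul (hcont n)).aestronglyMeasurable)
      (.of_forall fun n => .of_forall fun s _ => ?_)
      ((hc.abs.mul continuous_const).intervalIntegrable _ _)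
      (.of_forall fun s _ => (hlim s).const_mul (c s))
    rw [norm_mul, Real.norm_eq_abs, Real.norm_eq_abs]
    exact mul_le_mul_of_nonneg_left (hB n s) (abs_nonneg _)
  exact (((key (by fun_prop) _ _).const_mul _).add ((key (by fun_prop) _ _).const_mul _)).div_const _

end Green

/-- The right-hand side of the Duffing equation in the form `u'' = k² u - G`, evaluated at the
projection of the time variable to `[0, π]`. -/
noncomputable def duffingSource (ε lam k : ℝ) (h : ℝ → ℝ) (s : ℝ) : ℝ :=
  k ^ 2 * h (max 0 (min s π)) - (h (max 0 (min s π)) ^ 3 - lam * h (max 0 (min s π)) +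
    Real.cos (max 0 (min s π))) / ε ^ 2

lemma max_min_pi_mem (s : ℝ) : max 0 (min s π) ∈ Icc (0 : ℝ) π :=
  ⟨le_max_left _ _, max_le pi_pos.le (min_le_right _ _)⟩

lemma max_min_pi_eq {s : ℝ} (hs : s ∈ Icc (0 : ℝ) π) : max 0 (min s π) = s := by
  rw [min_eq_left hs.2, max_eq_right hs.1]

section Iteration

variable {ε lam k R : ℝ}

lemma duffingSource_of_mem {h : ℝ → ℝ} {t : ℝ} (ht : t ∈ Icc (0 : ℝ) π) :
    duffingSource ε lam k h t = k ^ 2 * h t - (h t ^ 3 - lam * h t + Real.cos t) / ε ^ 2 := by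
  rw [duffingSource, max_min_pi_eq ht]

lemma duffingSource_congr {g h : ℝ → ℝ} (hgh : ∀ t ∈ Icc (0 : ℝ) π, g t = h t) :
    duffingSource ε lam k g = duffingSource ε lam k h := by
  funext s
  simp only [duffingSource, hgh _ (max_min_pi_mem s)]

lemma continuous_duffingSource {h : ℝ → ℝ} (hh : Continuous h) :
    Continuous (duffingSource ε lam k h) := by
  unfold duffingSource
  fun_prop

lemma abs_duffingSource_le {h : ℝ → ℝ} (hh : ∀ t ∈ Icc (0 : ℝ) π, |h t| ≤ R) (s : ℝ) :
    |duffingSource ε lam k h s| ≤ k ^ 2 * R + (R ^ 3 + |lam| * R + 1) / ε ^ 2 := by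
  have hy := hh _ (max_min_pi_mem s)
  rw [duffingSource]
  generalize max 0 (min s π) = τ at *
  refine (abs_sub _ _).trans (add_le_add ?_ ?_)
  · rw [abs_mul, abs_of_nonneg (sq_nonneg k)]
    gcongr
  · rw [abs_div, abs_of_nonneg (sq_nonneg ε)]
    gcongr
    refine (abs_add_le _ _).trans (add_le_add ((abs_sub _ _).trans (add_le_add ?_ ?_))
      (Real.abs_cos_le_one τ))
    · rw [abs_pow]
      gcongr
    · rw [abs_mul]
      gcongr

/-- The nonlinearity `y ↦ k² y - (y³ - λ y) / ε²` is monotone on `[-R, R]`. -/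
lemma duffing_nonlinearity_mono (hε : 0 < ε) (hk : 3 * R ^ 2 - lam ≤ k ^ 2 * ε ^ 2) {x y c : ℝ}
    (hx : -R ≤ x) (hxy : x ≤ y) (hy : y ≤ R) :
    k ^ 2 * x - (x ^ 3 - lam * x + c) / ε ^ 2 ≤ k ^ 2 * y - (y ^ 3 - lam * y + c) / ε ^ 2 := by
  have h1 : x ^ 2 ≤ R ^ 2 := sq_le_sq' hx (hxy.trans hy)
  have h2 : y ^ 2 ≤ R ^ 2 := sq_le_sq' (hx.trans hxy) hy
  have h3 : 0 ≤ (y - x) * (k ^ 2 * ε ^ 2 + lam - (x ^ 2 + x * y + y ^ 2)) :=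
    mul_nonneg (sub_nonneg.2 hxy) (by nlinarith [sq_nonneg (x - y)])
  have h4 : (k ^ 2 * y - (y ^ 3 - lam * y + c) / ε ^ 2) -
      (k ^ 2 * x - (x ^ 3 - lam * x + c) / ε ^ 2) =
      ((y - x) * (k ^ 2 * ε ^ 2 + lam - (x ^ 2 + x * y + y ^ 2))) / ε ^ 2 := by
    field_simp
    ring
  rw [← sub_nonneg, h4]
  positivity

lemma neumannGreen_le_of_le (hk : 0 < k) {G w w' w'' : ℝ → ℝ} (hG : Continuous G)
    (h1 : ∀ t ∈ Icc (0 : ℝ) π, HasDerivAt w (w' t) t)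
    (h2 : ∀ t ∈ Icc (0 : ℝ) π, HasDerivAt w' (w'' t) t) (h0 : w' 0 = 0) (hpi : w' π = 0)
    (hle : ∀ t ∈ Icc (0 : ℝ) π, w'' t ≤ k ^ 2 * w t - G t) :
    ∀ t ∈ Icc (0 : ℝ) π, neumannGreen k G t ≤ w t := by
  have h := nonneg_of_neg_imp_concave pi_pos
    (fun t ht => (h1 t ht).fun_sub (hasDerivAt_neumannGreen hk hG t))
    (fun t ht => (h2 t ht).fun_sub (hasDerivAt_neumannGreenDeriv hk hG t))
    (by simp [h0, neumannGreenDeriv_zero]) (by simp [hpi, neumannGreenDeriv_pi]) ?_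
  · intro t ht
    linarith [h t ht]
  · intro t ht hneg
    have := mul_neg_of_pos_of_neg (sq_pos_of_pos hk) hneg
    linarith [hle t ht]

lemma le_neumannGreen_of_le (hk : 0 < k) {G w w' w'' : ℝ → ℝ} (hG : Continuous G)
    (h1 : ∀ t ∈ Icc (0 : ℝ) π, HasDerivAt w (w' t) t)
    (h2 : ∀ t ∈ Icc (0 : ℝ) π, HasDerivAt w' (w'' t) t) (h0 : w' 0 = 0) (hpi : w' π = 0)
    (hle : ∀ t ∈ Icc (0 : ℝ) π, k ^ 2 * w t - G t ≤ w'' t) :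
    ∀ t ∈ Icc (0 : ℝ) π, w t ≤ neumannGreen k G t := by
  have h := nonneg_of_neg_imp_concave pi_pos
    (fun t ht => (hasDerivAt_neumannGreen hk hG t).fun_sub (h1 t ht))
    (fun t ht => (hasDerivAt_neumannGreenDeriv hk hG t).fun_sub (h2 t ht))
    (by simp [h0, neumannGreenDeriv_zero]) (by simp [hpi, neumannGreenDeriv_pi]) ?_
  · intro t ht
    linarith [h t ht]
  · intro t ht hneg
    have := mul_neg_of_pos_of_neg (sq_pos_of_pos hk) hneg
    linarith [hle t ht]

lemma neg_le_neumannGreen_duffingSource (hε : 0 < ε) (hroot : R ^ 3 - lam * R = 1) (hk : 0 < k)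
    (hkR : 3 * R ^ 2 - lam ≤ k ^ 2 * ε ^ 2) {h : ℝ → ℝ} (hcont : Continuous h)
    (hh : ∀ t ∈ Icc (0 : ℝ) π, -R ≤ h t ∧ h t ≤ R) :
    ∀ t ∈ Icc (0 : ℝ) π, -R ≤ neumannGreen k (duffingSource ε lam k h) t := by
  refine le_neumannGreen_of_le (w := fun _ => -R) (w' := 0) (w'' := 0) hk
    (continuous_duffingSource hcont) (fun t _ => hasDerivAt_const t (-R))
    (fun t _ => hasDerivAt_const t 0) rfl rfl fun t ht => ?_
  have hmono := duffing_nonlinearity_mono (c := Real.cos t) hε hkR le_rfl (hh t ht).1 (hh t ht).2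
  rw [duffingSource_of_mem ht]
  have h2 : 0 ≤ (1 - Real.cos t) / ε ^ 2 :=
    div_nonneg (by linarith [Real.cos_le_one t]) (by positivity)
  have h3 : ((-R) ^ 3 - lam * -R + Real.cos t) / ε ^ 2 = -((1 - Real.cos t) / ε ^ 2) := by
    rw [← neg_div]
    congr 1
    linear_combination -hroot
  rw [h3] at hmono
  simp only [Pi.zero_apply]
  linarith

/-- Monotone iteration started at the constant supersolution `R`. -/
noncomputable def duffingIter (ε lam k R : ℝ) : ℕ → ℝ → ℝ
  | 0 => fun _ => R
  | n + 1 => neumannGreen k (duffingSource ε lam k (duffingIter ε lam k R n))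

lemma continuous_duffingIter (hk : 0 < k) : ∀ n, Continuous (duffingIter ε lam k R n)
  | 0 => continuous_const
  | n + 1 => continuous_iff_continuousAt.2 fun t => (hasDerivAt_neumannGreen hk
      (continuous_duffingSource (continuous_duffingIter hk n)) t).continuousAt

lemma IsNeumannSol.le_duffingIter (hε : 0 < ε) (hk : 0 < k)
    (hkR : 3 * R ^ 2 - lam ≤ k ^ 2 * ε ^ 2) {u u' : ℝ → ℝ} (hu : IsNeumannSol ε lam u u')
    (hlow : ∀ t ∈ Icc (0 : ℝ) π, -R ≤ u t) (n : ℕ)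
    (hn : ∀ t ∈ Icc (0 : ℝ) π, duffingIter ε lam k R n t ≤ R)
    (hle : ∀ t ∈ Icc (0 : ℝ) π, u t ≤ duffingIter ε lam k R n t) :
    ∀ t ∈ Icc (0 : ℝ) π, u t ≤ duffingIter ε lam k R (n + 1) t := by
  refine le_neumannGreen_of_le hk (continuous_duffingSource (continuous_duffingIter hk n))
    (fun t _ => hu.hasDerivAt t) hu.hasDerivAt_deriv hu.deriv_zero hu.deriv_pi fun t ht => ?_
  rw [duffingSource_of_mem ht]
  linarith [duffing_nonlinearity_mono (c := Real.cos t) hε hkR (hlow t ht) (hle t ht) (hn t ht)]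

lemma duffingIter_bounds (hε : 0 < ε) (hR : 0 < R) (hroot : R ^ 3 - lam * R = 1) (hk : 0 < k)
    (hkR : 3 * R ^ 2 - lam ≤ k ^ 2 * ε ^ 2) (n : ℕ) :
    ∀ t ∈ Icc (0 : ℝ) π, -R ≤ duffingIter ε lam k R (n + 1) t ∧
      duffingIter ε lam k R (n + 1) t ≤ duffingIter ε lam k R n t ∧
      duffingIter ε lam k R n t ≤ R := by
  induction n with
  | zero =>
    have hR' : ∀ t ∈ Icc (0 : ℝ) π, duffingSource ε lam k (duffingIter ε lam k R 0) t =
        k ^ 2 * R - (1 + Real.cos t) / ε ^ 2 := fun t ht => by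
      rw [duffingSource_of_mem ht]
      simp only [duffingIter, hroot]
    have hup := neumannGreen_le_of_le (w := fun _ => R) (w' := 0) (w'' := 0) hk
      (continuous_duffingSource (continuous_duffingIter hk 0)) (fun t _ => hasDerivAt_const t R)
      (fun t _ => hasDerivAt_const t 0) rfl rfl fun t ht => by
        rw [hR' t ht, sub_sub_cancel]
        have := Real.neg_one_le_cos t
        exact div_nonneg (by linarith) (by positivity)
    have hlow := neg_le_neumannGreen_duffingSource hε hroot hk hkR
      (continuous_duffingIter (ε := ε) (lam := lam) (k := k) (R := R) hk 0)
      fun t _ => (⟨by simp only [duffingIter]; linarith, le_rfl⟩ : _ ∧ _)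
    exact fun t ht => ⟨hlow t ht, hup t ht, le_rfl⟩
  | succ n ih =>
    have hcont := continuous_duffingSource (ε := ε) (lam := lam) (k := k)
      (continuous_duffingIter (ε := ε) (lam := lam) (R := R) hk n)
    have hup := neumannGreen_le_of_le hk
      (continuous_duffingSource (ε := ε) (lam := lam) (k := k)
        (continuous_duffingIter (ε := ε) (lam := lam) (R := R) hk (n + 1)))
      (fun t _ => hasDerivAt_neumannGreen hk hcont t)
      (fun t _ => hasDerivAt_neumannGreenDeriv hk hcont t) neumannGreenDeriv_zero
      neumannGreenDeriv_pi fun t ht => by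
        rw [duffingSource_of_mem ht, duffingSource_of_mem ht]
        obtain ⟨h1, h2, h3⟩ := ih t ht
        linarith [duffing_nonlinearity_mono (c := Real.cos t) hε hkR h1 h2 h3]
    have hlow := neg_le_neumannGreen_duffingSource hε hroot hk hkR
      (continuous_duffingIter (ε := ε) (lam := lam) (k := k) (R := R) hk (n + 1))
      fun t ht => ⟨(ih t ht).1, (ih t ht).2.1.trans (ih t ht).2.2⟩
    exact fun t ht => ⟨hlow t ht, hup t ht, (ih t ht).2.1.trans (ih t ht).2.2⟩

/-- There is a solution dominating every other solution. -/
lemma exists_maximal_isNeumannSol (hε : 0 < ε) (hR : 0 < R) (hroot : R ^ 3 - lam * R = 1)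
    (hlt : 4 * lam < 3 * R ^ 2) : ∃ U U' : ℝ → ℝ, IsNeumannSol ε lam U U' ∧
      ∀ u u' : ℝ → ℝ, IsNeumannSol ε lam u u' → ∀ t ∈ Icc (0 : ℝ) π, u t ≤ U t := by
  obtain ⟨k, hk, hkR⟩ : ∃ k > 0, 3 * R ^ 2 - lam ≤ k ^ 2 * ε ^ 2 := by
    have hpos : 0 < 3 * R ^ 2 - lam := by nlinarith [sq_pos_of_pos hR]
    refine ⟨√(3 * R ^ 2 - lam) / ε, by positivity, ?_⟩
    rw [div_pow, Real.sq_sqrt hpos.le, div_mul_cancel₀ _ (by positivity)]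
  set V := duffingIter ε lam k R with hV
  have hbd := fun n => duffingIter_bounds hε hR hroot hk hkR n
  have hlow : ∀ n, ∀ t ∈ Icc (0 : ℝ) π, -R ≤ V n t := fun n t ht =>
    (hbd n t ht).1.trans (hbd n t ht).2.1
  have hlim : ∀ t ∈ Icc (0 : ℝ) π,
      Filter.Tendsto (fun n => V n t) Filter.atTop (nhds (⨅ n, V n t)) := fun t ht =>
    tendsto_atTop_ciInf (antitone_nat_of_succ_le fun n => (hbd n t ht).2.1)
      ⟨-R, by rintro _ ⟨n, rfl⟩; exact hlow n t ht⟩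
  set L : ℝ → ℝ := fun t => ⨅ n, V n t with hL
  have hsrc : ∀ s, Filter.Tendsto (fun n => duffingSource ε lam k (V n) s) Filter.atTop
      (nhds (duffingSource ε lam k L s)) := fun s => by
    have h := hlim _ (max_min_pi_mem s)
    exact (h.const_mul _).sub ((((h.pow 3).sub (h.const_mul _)).add_const _).div_const _)
  have hsb : ∀ n s, |duffingSource ε lam k (V n) s| ≤
      k ^ 2 * R + (R ^ 3 + |lam| * R + 1) / ε ^ 2 := fun n =>
    abs_duffingSource_le fun t ht => abs_le.2 ⟨hlow n t ht, (hbd n t ht).2.2⟩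
  have hcont : ∀ n, Continuous (duffingSource ε lam k (V n)) := fun n =>
    continuous_duffingSource (continuous_duffingIter hk n)
  have hfix : ∀ t ∈ Icc (0 : ℝ) π, neumannGreen k (duffingSource ε lam k L) t = L t := fun t ht =>
    tendsto_nhds_unique (tendsto_neumannGreen hcont hsb hsrc t)
      ((Filter.tendsto_add_atTop_iff_nat 1).2 (hlim t ht))
  have hloc : MeasureTheory.LocallyIntegrable (duffingSource ε lam k L) := by
    have hmeas : Measurable (duffingSource ε lam k L) :=
      measurable_of_tendsto_metrizable (fun n => (hcont n).measurable) (tendsto_pi_nhds.2 hsrc)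
    refine (MeasureTheory.locallyIntegrable_const
      (k ^ 2 * R + (R ^ 3 + |lam| * R + 1) / ε ^ 2)).mono hmeas.aestronglyMeasurable
      (.of_forall fun s => ?_)
    have hb := le_of_tendsto (hsrc s).abs (.of_forall fun n => hsb n s)
    rw [Real.norm_eq_abs, Real.norm_eq_abs]
    exact hb.trans (le_abs_self _)
  have hG : Continuous (duffingSource ε lam k L) := by
    rw [← duffingSource_congr hfix]
    exact continuous_duffingSource (continuous_neumannGreen hloc)
  refine ⟨neumannGreen k (duffingSource ε lam k L), neumannGreenDeriv k (duffingSource ε lam k L),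
    ⟨hasDerivAt_neumannGreen hk hG, fun t ht => ?_, neumannGreenDeriv_zero, neumannGreenDeriv_pi⟩,
    fun u u' hu t ht => ?_⟩
  · refine (hasDerivAt_neumannGreenDeriv hk hG t).congr_deriv ?_
    rw [duffingSource_of_mem ht, hfix t ht]
    ring
  · rw [hfix t ht]
    have hle : ∀ n, ∀ t ∈ Icc (0 : ℝ) π, u t ≤ V n t := by
      intro n
      induction n with
      | zero => exact hu.le hε hroot hlt
      | succ n ih =>
        exact hu.le_duffingIter hε hk hkR (hu.neg_le hε hroot hlt) n
          (fun t ht => (hbd n t ht).2.2) ih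
    exact le_ciInf fun n => hle n t ht

end Iteration

lemma isNeumannSol_of_contDiff {ε lam : ℝ} {u : ℝ → ℝ} (hε : 0 < ε) (hu : ContDiff ℝ 2 u)
    (heq : ∀ t ∈ Icc (0 : ℝ) π,
      ε ^ 2 * deriv (deriv u) t = u t ^ 3 - lam * u t + Real.cos t)
    (h0 : deriv u 0 = 0) (hpi : deriv u π = 0) : IsNeumannSol ε lam u (deriv u) where
  hasDerivAt t := (hu.differentiable (by norm_num) t).hasDerivAt
  hasDerivAt_deriv t ht := by
    have hd : ContDiff ℝ 1 (deriv u) := ((contDiff_succ_iff_deriv (n := 1)).1 hu).2.2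
    refine (hd.differentiable (by norm_num) t).hasDerivAt.congr_deriv ?_
    rw [← heq t ht, mul_div_cancel_left₀ _ (by positivity)]
  deriv_zero := h0
  deriv_pi := hpi

/-- Uniqueness below the bifurcation value: for fixed `λ < λ₀ = 3/2^(2/3)`
there is `ε₀ > 0` such that for every `ε ∈ (0,ε₀)` any two solutions of the
Duffing equation on `[0,π]` with vanishing derivative at `0` and at `π`
coincide on `[0,π]` (so the antisymmetric solution `u_p` is the only one). -/
theorem stmt_19 (lam : ℝ)
    (hlam : lam < (3 : ℝ) / (2 : ℝ) ^ ((2 : ℝ) / 3)) :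
    ∃ ε₀ > (0 : ℝ), ∀ ε : ℝ, 0 < ε → ε < ε₀ →
      ∀ u v : ℝ → ℝ, ContDiff ℝ 2 u → ContDiff ℝ 2 v →
        (∀ t ∈ Icc (0 : ℝ) π,
          ε ^ 2 * deriv (deriv u) t = u t ^ 3 - lam * u t + Real.cos t) →
        (∀ t ∈ Icc (0 : ℝ) π,
          ε ^ 2 * deriv (deriv v) t = v t ^ 3 - lam * v t + Real.cos t) →
        deriv u 0 = 0 → deriv u π = 0 → deriv v 0 = 0 → deriv v π = 0 →
        ∀ t ∈ Icc (0 : ℝ) π, u t = v t := by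
  obtain ⟨R, hR, hroot, hlt⟩ := exists_cubic_root hlam
  obtain ⟨q, hqdef⟩ : ∃ q, q = 3 * R ^ 2 / 4 - lam := ⟨_, rfl⟩
  have hq : 0 < q := by linarith
  have hqR : 0 < 3 * R ^ 2 - lam := by nlinarith [sq_pos_of_pos hR]
  obtain ⟨δ, hδ, hδ1, hδq⟩ : ∃ δ > 0, δ ≤ 1 ∧ δ ^ 2 ≤ q * R / 2 := by
    refine ⟨min 1 √(q * R / 2), by positivity, min_le_left _ _, ?_⟩
    calc min 1 √(q * R / 2) ^ 2 ≤ √(q * R / 2) ^ 2 := by gcongr; exact min_le_right _ _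
      _ = q * R / 2 := Real.sq_sqrt (by positivity)
  have hcos : 0 < 1 - Real.cos δ := by
    have := Real.cos_lt_cos_of_nonneg_of_le_pi le_rfl (by linarith [pi_gt_three]) hδ
    rw [Real.cos_zero] at this
    linarith
  refine ⟨min √(q ^ 2 * R / 4) √(q ^ 2 * (1 - Real.cos δ) / (3 * R ^ 2 - lam)), by positivity, ?_⟩
  intro ε hε hε₀ u v hu hv hueq hveq hu0 hupi hv0 hvpi
  rw [lt_min_iff, Real.lt_sqrt hε.le, Real.lt_sqrt hε.le, lt_div_iff₀ hqR] at hε₀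
  have hu := isNeumannSol_of_contDiff hε hu hueq hu0 hupi
  have hv := isNeumannSol_of_contDiff hε hv hveq hv0 hvpi
  obtain ⟨U, U', hU, hmax⟩ := exists_maximal_isNeumannSol hε hR hroot hlt
  intro t ht
  rw [hu.eq_of_le hε hR hroot hq hqdef hδ hδ1 hδq hε₀.1.le hε₀.2 hU (hmax u _ hu) t ht,
    hv.eq_of_le hε hR hroot hq hqdef hδ hδ1 hδq hε₀.1.le hε₀.2 hU (hmax v _ hv) t ht]
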